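/- arXiv:math/0010180 — 5 statements merged into one kernel-verified Lean document; each statement's English description precedes it below -/
import Mathlib

section
/- Let A be a finite-dimensional semisimple unital associative algebra over ℂ, let ω be an element of the center of A, and let B be a finite-dimensional (A,A)-bimodule. Let F : B → ℂ be a ℂ-linear functional satisfying F(a·b) = F(b·a) for all a ∈ A and b ∈ B, and suppose there exist r ∈ ℂ and N ∈ ℕ such that F((ω − r)^N · b) = 0 for every b ∈ B (left action of (ω−r)^N). Then there exist an n ∈ ℕ, finite-dimensional simple left A-modules M^1, …, M^n on each of which ω acts as the scalar r, and ℂ-linear maps P_i : B → End_ℂ(M^i) (i = 1,…,n) satisfying P_i(a·b) = ρ_i(a) ∘ P_i(b) and P_i(b·a) = P_i(b) ∘ ρ_i(a) for all a ∈ A and b ∈ B (where ρ_i : A → End_ℂ(M^i) denotes the module action; such a P_i is the same datum as an A-module homomorphism B ⊗_A M^i → M^i), such that F(b) = Σ_{i=1}^n tr_{M^i}(P_i(b)) for all b ∈ B. -/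
open scoped MulOpposite

/-- A finite-dimensional representation of a `ℂ`-algebra `A`: a complex vector space
`M` together with an algebra map `ρ : A → End_ℂ(M)`. -/
structure RepData (A : Type) [Ring A] [Algebra ℂ A] where
  M : Type
  [addCommGroup : AddCommGroup M]
  [module : Module ℂ M]
  ρ : A →ₐ[ℂ] Module.End ℂ M

attribute [instance] RepData.addCommGroup RepData.module


section Helpers

variable {A : Type} [Ring A] [Algebra ℂ A] {n : ℕ} {d : Fin n → ℕ}

/-- Inclusion of the `i`-th matrix block into `A`. -/
noncomputable def blk (e : A ≃ₐ[ℂ] Π i, Matrix (Fin (d i)) (Fin (d i)) ℂ) (i : Fin n) :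
    Matrix (Fin (d i)) (Fin (d i)) ℂ →ₗ[ℂ] A :=
  e.symm.toLinearMap ∘ₗ LinearMap.single ℂ (fun i => Matrix (Fin (d i)) (Fin (d i)) ℂ) i

theorem mul_blk (e : A ≃ₐ[ℂ] Π i, Matrix (Fin (d i)) (Fin (d i)) ℂ) (i : Fin n) (a : A)
    (M : Matrix (Fin (d i)) (Fin (d i)) ℂ) : a * blk e i M = blk e i (e a i * M) := by
  apply e.injective
  simp only [blk, map_mul, LinearMap.comp_apply, AlgEquiv.toLinearMap_apply,
    AlgEquiv.apply_symm_apply, LinearMap.single_apply]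
  ext1 j
  by_cases h : j = i
  · subst h; simp
  · simp [Pi.single_eq_of_ne h]

theorem blk_mul (e : A ≃ₐ[ℂ] Π i, Matrix (Fin (d i)) (Fin (d i)) ℂ) (i : Fin n) (a : A)
    (M : Matrix (Fin (d i)) (Fin (d i)) ℂ) : blk e i M * a = blk e i (M * e a i) := by
  apply e.injective
  simp only [blk, map_mul, LinearMap.comp_apply, AlgEquiv.toLinearMap_apply,
    AlgEquiv.apply_symm_apply, LinearMap.single_apply]
  ext1 j
  by_cases h : j = i
  · subst h; simp
  · simp [Pi.single_eq_of_ne h]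

theorem sum_blk_one (e : A ≃ₐ[ℂ] Π i, Matrix (Fin (d i)) (Fin (d i)) ℂ) :
    ∑ i, blk e i 1 = 1 := by
  apply e.injective
  simp only [blk, map_sum, LinearMap.comp_apply, AlgEquiv.toLinearMap_apply,
    AlgEquiv.apply_symm_apply, LinearMap.single_apply, map_one]
  exact Finset.univ_sum_single (1 : Π i, Matrix (Fin (d i)) (Fin (d i)) ℂ)

variable {B : Type} [AddCommGroup B] [Module ℂ B] [Module A B] [IsScalarTower ℂ A B]

/-- The matrix of `P_i b`. -/
noncomputable def Pmat (e : A ≃ₐ[ℂ] Π i, Matrix (Fin (d i)) (Fin (d i)) ℂ) (F : B →ₗ[ℂ] ℂ)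
    (i : Fin n) : B →ₗ[ℂ] Matrix (Fin (d i)) (Fin (d i)) ℂ where
  toFun b := Matrix.of fun j k => F (blk e i (Matrix.single k j 1) • b)
  map_add' b c := by ext; simp
  map_smul' z b := by
    ext j k
    have : blk e i (Matrix.single k j 1) • z • b = z • blk e i (Matrix.single k j 1) • b := by
      rw [← algebraMap_smul A z b, ← algebraMap_smul A z (_ • b), smul_smul, smul_smul,
        Algebra.commutes]
    simp [this]

theorem trace_Pmat (e : A ≃ₐ[ℂ] Π i, Matrix (Fin (d i)) (Fin (d i)) ℂ) (F : B →ₗ[ℂ] ℂ)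
    (i : Fin n) (b : B) (M : Matrix (Fin (d i)) (Fin (d i)) ℂ) :
    (Pmat e F i b * M).trace = F (blk e i M • b) := by
  conv_rhs => rw [Matrix.matrix_eq_sum_single M]
  simp only [map_sum, Finset.sum_smul, Matrix.trace, Matrix.diag_apply, Matrix.mul_apply]
  rw [Finset.sum_comm]
  refine Finset.sum_congr rfl fun k _ => Finset.sum_congr rfl fun j _ => ?_
  have : Matrix.single k j (M k j) = M k j • Matrix.single k j (1 : ℂ) := by
    simp [Matrix.smul_single]
  rw [this, LinearMap.map_smul (blk e i), smul_assoc, LinearMap.map_smul F]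
  simp [Pmat, mul_comm]

/-- The simple module attached to the `i`-th block. -/
noncomputable def repBlk (e : A ≃ₐ[ℂ] Π i, Matrix (Fin (d i)) (Fin (d i)) ℂ) (i : Fin n) :
    RepData A where
  M := Fin (d i) → ℂ
  ρ := (Matrix.toLinAlgEquiv' : Matrix (Fin (d i)) (Fin (d i)) ℂ ≃ₐ[ℂ] _).toAlgHom.comp
    ((Pi.evalAlgHom ℂ (fun i => Matrix (Fin (d i)) (Fin (d i)) ℂ) i).comp e.toAlgHom)

theorem simple_std {m : ℕ} (W : Submodule ℂ (Fin m → ℂ))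
    (h : ∀ M : Matrix (Fin m) (Fin m) ℂ, ∀ w ∈ W, M.mulVec w ∈ W) : W = ⊥ ∨ W = ⊤ := by
  rw [or_iff_not_imp_left]
  intro hW
  obtain ⟨w, hw, hw0⟩ := Submodule.exists_mem_ne_zero_of_ne_bot hW
  obtain ⟨j, hj⟩ := Function.ne_iff.mp hw0
  rw [eq_top_iff]
  intro v _
  have := h (Matrix.of fun k l => if l = j then v k * (w j)⁻¹ else 0) w hw
  convert this using 1
  ext k
  simp only [Pi.zero_apply] at hj
  simp [Matrix.mulVec, dotProduct, hj]

end Helpers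

/-- Lemma 4.10 of the paper: Let `A` be a finite-dimensional semisimple unital associative
`ℂ`-algebra, `ω` a central element, `B` a finite-dimensional `(A,A)`-bimodule, and
`F : B → ℂ` a linear functional with `F(a·b) = F(b·a)` and `F((ω - r)^N · b) = 0` for all `b`.
Then there are finitely many finite-dimensional simple `A`-modules `M¹, …, Mⁿ` on which `ω`
acts as the scalar `r`, and linear maps `Pᵢ : B → End_ℂ(Mᵢ)` intertwining the left and right
`A`-actions (i.e. `A`-module maps `B ⊗_A Mᵢ → Mᵢ`), with `F(b) = Σᵢ tr_{Mᵢ}(Pᵢ(b))`. -/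
theorem stmt0 (A : Type) [Ring A] [Algebra ℂ A] [FiniteDimensional ℂ A]
    [IsSemisimpleRing A]
    (ω : A) (hω : ω ∈ Subalgebra.center ℂ A)
    (B : Type) [AddCommGroup B] [Module ℂ B] [FiniteDimensional ℂ B]
    [Module A B] [Module Aᵐᵒᵖ B] [SMulCommClass A Aᵐᵒᵖ B]
    [IsScalarTower ℂ A B] [IsScalarTower ℂ Aᵐᵒᵖ B]
    (F : B →ₗ[ℂ] ℂ)
    (hF : ∀ (a : A) (b : B), F (a • b) = F (MulOpposite.op a • b))
    (r : ℂ) (N : ℕ)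
    (hωr : ∀ b : B, F (((ω - algebraMap ℂ A r) ^ N) • b) = 0) :
    ∃ (n : ℕ) (D : Fin n → RepData A),
      (∀ i, FiniteDimensional ℂ (D i).M) ∧
      (∀ i, Nontrivial (D i).M) ∧
      -- each `Mᵢ` is a simple `A`-module: the only `A`-invariant subspaces are `⊥` and `⊤`
      (∀ i, ∀ W : Submodule ℂ (D i).M,
        (∀ a : A, ∀ w ∈ W, (D i).ρ a w ∈ W) → W = ⊥ ∨ W = ⊤) ∧
      -- `ω` acts on each `Mᵢ` as the scalar `r`
      (∀ i, (D i).ρ ω = r • (1 : Module.End ℂ (D i).M)) ∧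
      ∃ P : ∀ i, B →ₗ[ℂ] Module.End ℂ (D i).M,
        (∀ i (a : A) (b : B), P i (a • b) = (D i).ρ a * P i b) ∧
        (∀ i (a : A) (b : B), P i (MulOpposite.op a • b) = P i b * (D i).ρ a) ∧
        (∀ b : B, F b = ∑ i, LinearMap.trace ℂ (D i).M (P i b)) := by
  obtain ⟨m, d, hd, ⟨e⟩⟩ := IsSemisimpleRing.exists_algEquiv_pi_matrix_of_isAlgClosed ℂ A
  -- `ω` acts on each block by a scalar
  have hc : ∀ i, ∃ c : ℂ, e ω i = algebraMap ℂ _ c := by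
    intro i
    have : e ω i ∈ Subalgebra.center ℂ (Matrix (Fin (d i)) (Fin (d i)) ℂ) := by
      rw [Subalgebra.mem_center_iff]
      intro M
      have h1 := Subalgebra.mem_center_iff.mp hω (blk e i M)
      rw [blk_mul, mul_blk] at h1
      have h2 := congrFun (congrArg e h1) i
      simpa [blk] using h2
    rw [Algebra.IsCentral.center_eq_bot] at this
    obtain ⟨c, hc⟩ := Algebra.mem_bot.mp this
    exact ⟨c, hc.symm⟩
  choose c hc using hc
  have hzero : ∀ i, c i ≠ r → ∀ b, (Pmat e F i b).trace = 0 := by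
    intro i hi b
    have h1 := hωr (blk e i 1 • b)
    rw [smul_smul, mul_blk] at h1
    have h2 : e ((ω - algebraMap ℂ A r) ^ N) i = algebraMap ℂ _ ((c i - r) ^ N) := by
      simp [hc i]
    rw [h2, mul_one, Algebra.algebraMap_eq_smul_one, LinearMap.map_smul (blk e i), smul_assoc,
      LinearMap.map_smul F] at h1
    have h3 := trace_Pmat e F i b 1
    rw [mul_one] at h3
    rw [h3]
    exact (smul_eq_zero.mp h1).resolve_left (pow_ne_zero _ (sub_ne_zero.mpr hi))
  let φ := Fintype.equivFin {i // c i = r}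
  refine ⟨_, fun k => repBlk e (φ.symm k).1, ?_, ?_, ?_, ?_,
    fun k => (Matrix.toLinAlgEquiv' : Matrix (Fin (d (φ.symm k).1)) (Fin (d (φ.symm k).1)) ℂ ≃ₐ[ℂ]
      _).toLinearMap ∘ₗ Pmat e F (φ.symm k).1, ?_, ?_, ?_⟩
  · intro k
    exact inferInstanceAs (FiniteDimensional ℂ (Fin (d (φ.symm k).1) → ℂ))
  · intro k
    have := hd (φ.symm k).1
    exact inferInstanceAs (Nontrivial (Fin (d (φ.symm k).1) → ℂ))
  · intro k W hW
    refine simple_std (m := d (φ.symm k).1) W fun M w hw => ?_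
    have := hW (blk e _ M) w hw
    change Matrix.toLinAlgEquiv' (e (blk e _ M) (φ.symm k).1) w ∈ W at this
    have h2 : e (blk e _ M) (φ.symm k).1 = M := by simp [blk]
    rw [h2] at this
    exact this
  · intro k
    have h := hc (φ.symm k).1
    rw [(φ.symm k).2, Algebra.algebraMap_eq_smul_one] at h
    change Matrix.toLinAlgEquiv' (e ω (φ.symm k).1) = _
    rw [h, map_smul, map_one]
    rfl
  · intro k a b
    have h : Pmat e F (φ.symm k).1 (a • b) = e a (φ.symm k).1 * Pmat e F (φ.symm k).1 b := by
      refine Matrix.ext_iff_trace_mul_right.mpr fun M => ?_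
      rw [trace_Pmat, smul_smul, blk_mul, ← trace_Pmat, mul_assoc, Matrix.trace_mul_comm (e a _),
        mul_assoc]
    exact (congrArg Matrix.toLinAlgEquiv' h).trans (map_mul Matrix.toLinAlgEquiv' _ _)
  · intro k a b
    have h : Pmat e F (φ.symm k).1 (MulOpposite.op a • b) =
        Pmat e F (φ.symm k).1 b * e a (φ.symm k).1 := by
      refine Matrix.ext_iff_trace_mul_right.mpr fun M => ?_
      rw [trace_Pmat, smul_comm, ← hF, smul_smul, mul_blk, ← trace_Pmat, mul_assoc]
    exact (congrArg Matrix.toLinAlgEquiv' h).trans (map_mul Matrix.toLinAlgEquiv' _ _)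
  · intro b
    have h1 : F b = ∑ i, (Pmat e F i b).trace := by
      conv_lhs => rw [← one_smul A b, ← sum_blk_one e, Finset.sum_smul, map_sum]
      refine Finset.sum_congr rfl fun i _ => ?_
      rw [← trace_Pmat, mul_one]
    have h2 : ∀ i, LinearMap.trace ℂ (Fin (d i) → ℂ)
        (Matrix.toLinAlgEquiv' (Pmat e F i b)) = (Pmat e F i b).trace := fun i =>
      Matrix.trace_toLin'_eq _
    calc F b = ∑ i, (Pmat e F i b).trace := h1
      _ = ∑ i : {i // c i = r}, (Pmat e F i.1 b).trace := by
        rw [← Finset.sum_subtype (Finset.univ.filter fun i => c i = r) (by simp)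
          (fun i => (Pmat e F i b).trace)]
        refine (Finset.sum_subset (Finset.filter_subset _ _) fun i _ hi => ?_).symm
        exact hzero i (by simpa using hi) b
      _ = ∑ k, (Pmat e F (φ.symm k).1 b).trace := (Equiv.sum_comp φ.symm _).symm
      _ = _ := Finset.sum_congr rfl fun k _ => (h2 _).symm
end

section
/- Let t ∈ ℝ with −1 < t ≤ 1, let m ∈ ℤ, and set k = t + 2m. Let V be the ℂ-vector space of all functions f : ℍ → ℂ, and define ℂ-linear maps T_S, T_T : V → V by (T_S f)(τ) = (−iτ)^{−t} · τ^{t−k} · f(−1/τ) and (T_T f)(τ) = e^{−iπt/6} · f(τ + 1), where (−iτ)^{−t} is the principal complex power and τ^{t−k} = τ^{−2m} is the integer power. Then T_S ∘ T_S = id_V and (T_S ∘ T_T)∘(T_S ∘ T_T)∘(T_S ∘ T_T) = id_V; consequently there exists a group homomorphism ρ from SL(2,ℤ) to the group of ℂ-linear automorphisms of V with ρ(S) = T_S and ρ(T) = T_T, where S = [[0,−1],[1,0]] and T = [[1,1],[0,1]]. -/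
open UpperHalfPlane

/-- The operator `(T_S f)(τ) = (-iτ)^{-t} · τ^{-2m} · f(-1/τ)` on functions on the
upper half-plane, where `(-iτ)^{-t}` is the principal complex power and
`τ^{t-k} = τ^{-2m}` is an integer power. -/
noncomputable def TS (t : ℝ) (m : ℤ) : (ℍ → ℂ) →ₗ[ℂ] (ℍ → ℂ) where
  toFun f := fun τ =>
    (-Complex.I * (τ : ℂ)) ^ (-(t : ℂ)) * (τ : ℂ) ^ (-(2 * m)) * f (ModularGroup.S • τ)
  map_add' f g := by
    funext τ
    simp [mul_add]
  map_smul' c f := by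
    funext τ
    simp [smul_eq_mul]
    ring

/-- The operator `(T_T f)(τ) = e^{-iπt/6} · f(τ + 1)` on functions on the
upper half-plane. -/
noncomputable def TT (t : ℝ) : (ℍ → ℂ) →ₗ[ℂ] (ℍ → ℂ) where
  toFun f := fun τ =>
    Complex.exp (-(Complex.I * Real.pi * t) / 6) * f (ModularGroup.T • τ)
  map_add' f g := by
    funext τ
    simp [mul_add]
  map_smul' c f := by
    funext τ
    simp [smul_eq_mul]
    ring

/-- A continuous function on `ℍ` with constant exponential is constant. -/
lemma const_of_exp_const (F : ℍ → ℂ) (hF : Continuous F) (c : ℂ)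
    (h : ∀ τ, Complex.exp (F τ) = c) (x y : ℍ) : F x = F y := by
  have key : ∀ τ, ∃ n : ℤ, F τ = F y + n * (2 * Real.pi * Complex.I) := fun τ =>
    Complex.exp_eq_exp_iff_exists_int.1 ((h τ).trans (h y).symm)
  choose n hn using key
  have hpi : (2 * Real.pi : ℝ) ≠ 0 := by positivity
  have hn' : ∀ τ, ((n τ : ℤ) : ℝ) = (F τ - F y).im / (2 * Real.pi) := by
    intro τ
    rw [hn τ]
    field_simp
    simp
  have hc : Continuous (fun τ => ((n τ : ℤ) : ℝ)) := by
    simp_rw [hn']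
    fun_prop
  have hcn : Continuous n := Int.isClosedEmbedding_coe_real.isEmbedding.continuous_iff.2 hc
  have h1 : n x = n y := PreconnectedSpace.constant inferInstance hcn
  rw [hn x, h1, ← hn y]

lemma log_neg_I_mul (τ : ℍ) :
    Complex.log (-Complex.I * (τ : ℂ)) = Complex.log τ - Complex.log Complex.I := by
  have h0 : (τ : ℂ) ≠ 0 := τ.ne_zero
  have h1 : 0 < (τ : ℂ).im := τ.2
  have h2 : 0 ≤ Complex.arg (τ : ℂ) := Complex.arg_nonneg_iff.2 h1.le
  have h3 := Complex.arg_le_pi (τ : ℂ)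
  have hp := Real.pi_pos
  rw [Complex.log_mul (by simp) h0, Complex.log_neg_I, Complex.log_I]
  · ring
  · rw [Complex.arg_neg_I]
    constructor <;> linarith

lemma exists_log_eta : ∃ L : ℍ → ℂ, Continuous L ∧ ∀ τ : ℍ, Complex.exp (L τ) = ModularForm.eta τ := by
  have hconv : Convex ℝ upperHalfPlaneSet := convex_halfSpace_im_gt 0
  have hne : upperHalfPlaneSet.Nonempty := ⟨Complex.I, by simp⟩
  have hsc : IsSimplyConnected upperHalfPlaneSet := by
    have := Convex.contractibleSpace hconv hne
    unfold IsSimplyConnected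
    infer_instance
  obtain ⟨L, hL, hL2⟩ := Complex.exists_continuousOn_eqOn_exp_comp (U := upperHalfPlaneSet)
    (g := ModularForm.eta) hsc isOpen_upperHalfPlaneSet
    (fun z hz => (ModularForm.differentiableAt_eta_of_mem_upperHalfPlaneSet hz).continuousAt.continuousWithinAt)
    (by rintro ⟨z, hz, h⟩; exact ModularForm.eta_ne_zero hz h)
  refine ⟨fun τ => L τ, hL.comp_continuous continuous_coe (fun τ => τ.2), fun τ => ?_⟩
  exact hL2 τ.2

lemma coe_S_smul (τ : ℍ) : ((ModularGroup.S • τ : ℍ) : ℂ) = -1 / (τ : ℂ) := by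
  rw [modular_S_smul]; simp [neg_div, inv_neg]

lemma coe_T_smul (τ : ℍ) : ((ModularGroup.T • τ : ℍ) : ℂ) = (τ : ℂ) + 1 := by
  rw [modular_T_smul]; simp [add_comm]

lemma continuous_S_smul : Continuous (fun τ : ℍ => (ModularGroup.S • τ : ℍ)) := by
  rw [isOpenEmbedding_coe.isInducing.continuous_iff]
  have : (UpperHalfPlane.coe ∘ fun τ : ℍ => (ModularGroup.S • τ : ℍ)) =
      fun τ : ℍ => -1 / (τ : ℂ) := funext coe_S_smul
  rw [this]
  exact continuous_const.div continuous_coe (fun τ => τ.ne_zero)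

lemma continuous_T_smul : Continuous (fun τ : ℍ => (ModularGroup.T • τ : ℍ)) := by
  rw [isOpenEmbedding_coe.isInducing.continuous_iff]
  have : (UpperHalfPlane.coe ∘ fun τ : ℍ => (ModularGroup.T • τ : ℍ)) =
      fun τ : ℍ => (τ : ℂ) + 1 := funext coe_T_smul
  rw [this]
  exact continuous_coe.add continuous_const

lemma eta_add_one (τ : ℍ) : ModularForm.eta ((τ : ℂ) + 1) =
    Complex.exp (2 * Real.pi * Complex.I / 24) * ModularForm.eta τ := by
  unfold ModularForm.eta
  have : ∀ n, ModularForm.eta_q n ((τ : ℂ) + 1) = ModularForm.eta_q n τ := by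
    intro n
    have : Function.Periodic.qParam 1 ((τ : ℂ) + 1) = Function.Periodic.qParam 1 (τ : ℂ) := by
      simp only [Function.Periodic.qParam, Complex.ofReal_one, div_one]
      rw [mul_add, mul_one, Complex.exp_add, Complex.exp_two_pi_mul_I, mul_one]
    rw [ModularForm.eta_q, this]
  simp_rw [this]
  rw [← mul_assoc]
  congr 1
  simp only [Function.Periodic.qParam]
  rw [← Complex.exp_add]
  congr 1
  push_cast
  ring

lemma exists_L : ∃ L : ℍ → ℂ,
    (∀ τ : ℍ, L (ModularGroup.S • τ) = L τ + Complex.log (-Complex.I * τ) / 2) ∧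
    (∀ τ : ℍ, L (ModularGroup.T • τ) = L τ + Real.pi * Complex.I / 12) := by
  obtain ⟨L, hLc, hL⟩ := exists_log_eta
  have hS : ∀ τ : ℍ, L (ModularGroup.S • τ) = L τ + Complex.log (-Complex.I * τ) / 2 := by
    intro τ
    have hcont : Continuous (fun τ : ℍ => L (ModularGroup.S • τ) - L τ - Complex.log (τ : ℂ) / 2) := by
      refine ((hLc.comp (continuous_S_smul)).sub hLc).sub (Continuous.div_const ?_ _)
      exact continuous_coe.clog (fun τ => mem_slitPlane τ)
    have h := const_of_exp_const _ hcont ((Complex.sqrt Complex.I)⁻¹) (fun τ => by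
      rw [Complex.exp_sub, Complex.exp_sub, hL, hL, coe_S_smul]
      have h1 := ModularForm.eta_comp_eq_csqrt_I_inv τ.2
      simp only [Function.comp_apply, Pi.smul_apply, Pi.mul_apply, smul_eq_mul] at h1
      have h2 : Complex.sqrt (τ : ℂ) = Complex.exp (Complex.log (τ : ℂ) / 2) := by
        rw [Complex.sqrt, Complex.cpow_def_of_ne_zero τ.ne_zero]
        congr 1
      rw [h1, ← h2]
      have h3 : Complex.sqrt (τ : ℂ) ≠ 0 := by rw [h2]; exact Complex.exp_ne_zero _
      have h4 := ModularForm.eta_ne_zero τ.2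
      field_simp) τ UpperHalfPlane.I
    have hI : (ModularGroup.S • UpperHalfPlane.I : ℍ) = UpperHalfPlane.I := by
      ext1
      rw [coe_S_smul]
      simp
    simp only [hI, coe_I] at h
    rw [log_neg_I_mul]
    linear_combination h
  refine ⟨L, hS, fun τ => ?_⟩
  have hcont : Continuous (fun τ : ℍ => L (ModularGroup.T • τ) - L τ) :=
    (hLc.comp (continuous_T_smul)).sub hLc
  let w : ℍ := ⟨Complex.exp (2 * Real.pi / 3 * Complex.I), by
    rw [show (2 * Real.pi / 3 * Complex.I : ℂ) = ((2 * Real.pi / 3 : ℝ) : ℂ) * Complex.I by push_cast; ring,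
      Complex.exp_ofReal_mul_I_im]
    have hp := Real.pi_pos
    exact Real.sin_pos_of_pos_of_lt_pi (by linarith) (by linarith)⟩
  have hwc : (w : ℂ) = Complex.exp (2 * Real.pi / 3 * Complex.I) := rfl
  have h := const_of_exp_const _ hcont (Complex.exp (2 * Real.pi * Complex.I / 24)) (fun τ => by
    rw [Complex.exp_sub, hL, hL, coe_T_smul, eta_add_one]
    have h4 := ModularForm.eta_ne_zero τ.2
    field_simp) τ w
  have hw : (ModularGroup.T • w : ℍ) = ModularGroup.S • w := by
    ext1
    rw [coe_S_smul, coe_T_smul]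
    have hw0 : (w : ℂ) ≠ 0 := w.ne_zero
    have hw3 : (w : ℂ) ^ 3 = 1 := by
      rw [hwc, ← Complex.exp_nat_mul, ← Complex.exp_two_pi_mul_I]
      congr 1
      push_cast
      ring
    have hw1 : (w : ℂ) - 1 ≠ 0 := by
      intro h
      have h5 : 0 < (w : ℂ).im := w.2
      rw [sub_eq_zero.1 h] at h5
      simp at h5
    have hq : (w : ℂ) ^ 2 + w + 1 = 0 := by
      apply mul_left_cancel₀ hw1
      linear_combination hw3
    field_simp
    linear_combination hq
  have hlog : Complex.log (-Complex.I * w) = Real.pi / 6 * Complex.I := by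
    rw [log_neg_I_mul, Complex.log_I]
    have hp := Real.pi_pos
    have him : (2 * Real.pi / 3 * Complex.I : ℂ).im = 2 * Real.pi / 3 := by
      rw [show (2 * Real.pi / 3 * Complex.I : ℂ) = ((2 * Real.pi / 3 : ℝ) : ℂ) * Complex.I by push_cast; ring]
      simp only [Complex.mul_I_im, Complex.ofReal_re]
    rw [hwc, Complex.log_exp (by rw [him]; linarith) (by rw [him]; linarith)]
    ring
  simp only [hw, hS w, hlog] at h
  linear_combination h

/-- The anti-automorphism of `SL(2,ℤ)` fixing `S` and `T`. -/
def sig (g : Matrix.SpecialLinearGroup (Fin 2) ℤ) : Matrix.SpecialLinearGroup (Fin 2) ℤ :=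
  ⟨!![g 1 1, g 0 1; g 1 0, g 0 0], by
    have := g.det_coe
    rw [Matrix.det_fin_two] at this
    rw [Matrix.det_fin_two_of]
    linarith⟩

lemma sig_mul (g h : Matrix.SpecialLinearGroup (Fin 2) ℤ) : sig (g * h) = sig h * sig g := by
  ext i j
  rw [Matrix.SpecialLinearGroup.coe_mul]
  fin_cases i <;> fin_cases j <;> simp [sig, Matrix.SpecialLinearGroup.coe_mul, Matrix.mul_apply, Fin.sum_univ_two] <;> ring

lemma sig_one : sig 1 = 1 := by
  ext i j
  fin_cases i <;> fin_cases j <;> simp [sig]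

lemma sig_S : sig ModularGroup.S = ModularGroup.S := by
  ext i j
  fin_cases i <;> fin_cases j <;> simp [sig, ModularGroup.S]

lemma sig_T : sig ModularGroup.T = ModularGroup.T := by
  ext i j
  fin_cases i <;> fin_cases j <;> simp [sig, ModularGroup.T]

open ModularForm in
/-- The weight `2m` slash action conjugated by multiplication by `h`. -/
noncomputable def repEnd (h : ℍ → ℂ) (h0 : ∀ τ, h τ ≠ 0) (m : ℤ) :
    Matrix.SpecialLinearGroup (Fin 2) ℤ →* Module.End ℂ (ℍ → ℂ) where
  toFun g :=
    { toFun := fun f => h * ((h⁻¹ * f) ∣[(2 * m : ℤ)] (sig g))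
      map_add' := fun f₁ f₂ => by
        rw [mul_add, SlashAction.add_slash, mul_add]
      map_smul' := fun c f => by
        rw [mul_smul_comm, SL_smul_slash, mul_smul_comm]; rfl }
  map_one' := by
    ext f τ
    simp [sig_one, h0 τ]
  map_mul' g₁ g₂ := by
    ext1 f
    simp only [LinearMap.coe_mk, AddHom.coe_mk, Module.End.mul_apply, sig_mul]
    rw [SlashAction.slash_mul, ← mul_assoc h⁻¹ h, show h⁻¹ * h = 1 by ext τ; simp [h0 τ], one_mul]

lemma repEnd_apply (h : ℍ → ℂ) (h0 : ∀ τ, h τ ≠ 0) (m : ℤ)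
    (g : Matrix.SpecialLinearGroup (Fin 2) ℤ) (f : ℍ → ℂ) (τ : ℍ) :
    repEnd h h0 m g f τ =
      h τ * ((h (sig g • τ))⁻¹ * f (sig g • τ) * denom (sig g) τ ^ (-(2 * m))) := by
  change (h * _ : ℍ → ℂ) τ = _
  rw [Pi.mul_apply, ModularForm.SL_slash_apply]
  rfl

/-- Lemma 5.2 of the paper: for `-1 < t ≤ 1`, `m ∈ ℤ`, `k = t + 2m`, the operators
`T_S` and `T_T` satisfy `T_S² = 1` and `(T_S T_T)³ = 1`, and hence extend to a
representation `ρ` of `SL(2,ℤ)` on the space of functions on the upper half-plane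
with `ρ(S) = T_S` and `ρ(T) = T_T`. -/
theorem stmt3 (t : ℝ) (ht1 : -1 < t) (ht2 : t ≤ 1) (m : ℤ) :
    TS t m ∘ₗ TS t m = LinearMap.id ∧
    (TS t m ∘ₗ TT t) ∘ₗ ((TS t m ∘ₗ TT t) ∘ₗ (TS t m ∘ₗ TT t)) = LinearMap.id ∧
    ∃ ρ : Matrix.SpecialLinearGroup (Fin 2) ℤ →* (Module.End ℂ (ℍ → ℂ))ˣ,
      ((ρ ModularGroup.S : (Module.End ℂ (ℍ → ℂ))ˣ) : Module.End ℂ (ℍ → ℂ)) = TS t m ∧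
      ((ρ ModularGroup.T : (Module.End ℂ (ℍ → ℂ))ˣ) : Module.End ℂ (ℍ → ℂ)) = TT t := by
  obtain ⟨L, hS, hT⟩ := exists_L
  let h : ℍ → ℂ := fun τ => Complex.exp (2 * t * L τ)
  have h0 : ∀ τ, h τ ≠ 0 := fun τ => Complex.exp_ne_zero _
  let R := repEnd h h0 m
  have hRS : R ModularGroup.S = TS t m := by
    ext f τ
    change repEnd h h0 m _ f τ = (-Complex.I * (τ : ℂ)) ^ (-(t : ℂ)) * (τ : ℂ) ^ (-(2 * m)) *
      f (ModularGroup.S • τ)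
    rw [repEnd_apply, sig_S, ModularGroup.denom_S]
    have h1 : (-Complex.I * (τ : ℂ)) ^ (-(t : ℂ)) = h τ * (h (ModularGroup.S • τ))⁻¹ := by
      rw [Complex.cpow_def_of_ne_zero (mul_ne_zero (by simp) τ.ne_zero)]
      simp only [h, hS]
      rw [← Complex.exp_neg, ← Complex.exp_add]
      congr 1
      ring
    rw [h1]
    ring
  have hRT : R ModularGroup.T = TT t := by
    ext f τ
    change repEnd h h0 m _ f τ = Complex.exp (-(Complex.I * Real.pi * t) / 6) *
      f (ModularGroup.T • τ)
    rw [repEnd_apply, sig_T]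
    have hd : denom (ModularGroup.T : Matrix.SpecialLinearGroup (Fin 2) ℤ) τ = 1 := by
      rw [ModularGroup.denom_apply]
      simp [ModularGroup.T]
    have h1 : Complex.exp (-(Complex.I * Real.pi * t) / 6) = h τ * (h (ModularGroup.T • τ))⁻¹ := by
      simp only [h, hT]
      rw [← Complex.exp_neg, ← Complex.exp_add]
      congr 1
      ring
    rw [h1, hd, one_zpow]
    ring
  have hneg : R (-1) = 1 := by
    ext1 f
    funext τ
    change repEnd h h0 m _ f τ = f τ
    have hs : sig (-1) = -1 := by
      ext i j
      fin_cases i <;> fin_cases j <;> simp [sig]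
    have hd : denom ((-1 : Matrix.SpecialLinearGroup (Fin 2) ℤ)) τ = -1 := by
      rw [ModularGroup.denom_apply]
      simp
    rw [repEnd_apply, hs, hd, Even.neg_one_zpow ⟨-m, by ring⟩, ModularGroup.SL_neg_smul, one_smul]
    field_simp [h0 τ]
  refine ⟨?_, ?_, R.toHomUnits, ?_, ?_⟩
  · rw [← hRS]
    change R ModularGroup.S * R ModularGroup.S = 1
    rw [← map_mul, show ModularGroup.S * ModularGroup.S = -1 by decide, hneg]
  · rw [← hRS, ← hRT]
    change (R ModularGroup.S * R ModularGroup.T) * ((R ModularGroup.S * R ModularGroup.T) *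
      (R ModularGroup.S * R ModularGroup.T)) = 1
    rw [← map_mul, ← map_mul, ← map_mul, ← hneg]
    congr 1
    decide
  · simpa using hRS
  · simpa using hRT
end

section
/- Let τ lie in the complex upper half-plane and set q = e^{2πiτ}. There exists δ > 0 (depending on τ) such that for every z ∈ ℂ with 0 < |z| < δ and −2π·Im τ < Re z < 0 (so that |q| < |e^z| < 1 and P₁(e^z,q) is defined), one has P₁(e^z, q) = −z^{−1} − 1/2 + Σ_{k=1}^{∞} E_{2k}(τ)·z^{2k−1}, with the series on the right converging absolutely. -/
open Complex

/-- Zhu's series `P_k(z,q) = (1/(k-1)!) Σ_{n≥1} ( n^{k-1} zⁿ/(1-qⁿ)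
+ (-1)^k n^{k-1} z^{-n} qⁿ/(1-qⁿ) )`, defined for `|q| < |z| < 1`. -/
noncomputable def Pk (k : ℕ) (z q : ℂ) : ℂ :=
  (((k - 1).factorial : ℂ))⁻¹ *
    ∑' n : ℕ,
      (((n : ℂ) + 1) ^ (k - 1) * z ^ (n + 1) / (1 - q ^ (n + 1)) +
        (-1 : ℂ) ^ k * ((n : ℂ) + 1) ^ (k - 1) * z ^ (-((n : ℤ) + 1)) * q ^ (n + 1) /
          (1 - q ^ (n + 1)))

/-- The normalized Eisenstein series `E_{2k}(τ)` for `τ` in the upper half-plane and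
`q = e^{2πiτ}`: `E₂(τ) = -1/12 + 2 Σ_{n≥1} n·qⁿ/(1-qⁿ)` and, for `k ≥ 2`,
`E_{2k}(τ) = 2ζ(2k)/(2πi)^{2k} + (2/(2k-1)!) Σ_{n≥1} n^{2k-1}·qⁿ/(1-qⁿ)`. -/
noncomputable def E2k (k : ℕ) (τ : ℂ) : ℂ :=
  if k = 1 then
    -1 / 12 + 2 * ∑' n : ℕ,
      ((n : ℂ) + 1) * Complex.exp (2 * Real.pi * Complex.I * τ) ^ (n + 1) /
        (1 - Complex.exp (2 * Real.pi * Complex.I * τ) ^ (n + 1))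
  else
    2 * riemannZeta (2 * k) / (2 * Real.pi * Complex.I) ^ (2 * k) +
      (2 / ((2 * k - 1).factorial : ℂ)) * ∑' n : ℕ,
        ((n : ℂ) + 1) ^ (2 * k - 1) * Complex.exp (2 * Real.pi * Complex.I * τ) ^ (n + 1) /
          (1 - Complex.exp (2 * Real.pi * Complex.I * τ) ^ (n + 1))

lemma HasSum.congr_fun_aux {α : Type*} [NormedAddCommGroup α] {f g : ℕ → α} {a : α}
    (h : HasSum f a) (e : ∀ n, g n = f n) : HasSum g a := by
  rwa [funext e]

lemma HasSum.congr_val_aux {α : Type*} [NormedAddCommGroup α] {f : ℕ → α} {a b : α}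
    (h : HasSum f a) (e : b = a) : HasSum f b := by
  rwa [e]

lemma swap_aux (F : ℕ → ℕ → ℂ) (S : ℕ → ℂ) (G' G : ℕ → ℝ)
    (h1 : ∀ n, HasSum (fun k => F n k) (S n))
    (h2 : ∀ n, HasSum (fun k => ‖F n k‖) (G' n))
    (h3 : ∀ n, G' n ≤ G n) (h4 : Summable G) :
    (Summable fun k => ‖∑' n, F n k‖) ∧ HasSum S (∑' k, ∑' n, F n k) := by
  have hG' : ∀ n, 0 ≤ G' n := fun n => (h2 n).nonneg (fun _ => norm_nonneg _)
  have hN : Summable (fun p : ℕ × ℕ => ‖F p.1 p.2‖) := by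
    rw [summable_prod_of_nonneg (fun _ => norm_nonneg _)]
    refine ⟨fun n => (h2 n).summable, ?_⟩
    simp only [(h2 _).tsum_eq]
    exact Summable.of_nonneg_of_le hG' h3 h4
  have hF : Summable (fun p : ℕ × ℕ => F p.1 p.2) := hN.of_norm
  have hNs : Summable (fun p : ℕ × ℕ => ‖F p.2 p.1‖) := hN.prod_symm
  constructor
  · have h5 := (summable_prod_of_nonneg (fun _ => norm_nonneg _)).1 hNs
    exact Summable.of_nonneg_of_le (fun _ => norm_nonneg _)
      (fun k => norm_tsum_le_tsum_norm (h5.1 k)) h5.2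
  · have := hF.hasSum.prod_fiberwise h1
    have e : ∑' p : ℕ × ℕ, F p.1 p.2 = ∑' k, ∑' n, F n k := by
      rw [hF.tsum_prod]
      exact Summable.tsum_comm (f := fun k n => F n k) hF.prod_symm
    rwa [e] at this

lemma sq_summable_aux : Summable (fun n : ℕ => 1 / ((n : ℝ) + 1) ^ 2) := by
  have := (summable_nat_add_iff 1).2 (Real.summable_one_div_nat_pow.2 (by norm_num : 1 < 2))
  simpa using this

lemma zeta_term_aux (x : ℂ) : ∀ k : ℕ, 2 * x ^ (2 * k + 1) * riemannZeta (2 * (k + 1 : ℕ)) =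
      ∑' n : ℕ, (2 * x / ((n : ℂ) + 1) ^ 2) * ((x / ((n : ℂ) + 1)) ^ 2) ^ k := by
    intro k
    have : (2 * ((k + 1 : ℕ) : ℂ)) = ((2 * (k + 1) : ℕ) : ℂ) := by push_cast; ring
    rw [this, zeta_eq_tsum_one_div_nat_add_one_cpow, ← tsum_mul_left]
    · refine tsum_congr fun n => ?_
      have : (n : ℂ) + 1 ≠ 0 := by exact_mod_cast Nat.succ_ne_zero n
      rw [Complex.cpow_natCast, ← pow_mul, div_pow]
      field_simp
      ring
    · simp only [Complex.natCast_re]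
      exact_mod_cast (by omega : 1 < 2 * (k + 1))

lemma geo_aux (A y : ℂ) (hy : ‖y‖ < 1) : HasSum (fun k : ℕ => A * y ^ k) (A * (1 - y)⁻¹) :=
  (hasSum_geometric_of_norm_lt_one hy).mul_left A

lemma geo_norm_aux (A y : ℂ) (hy : ‖y‖ < 1) :
    HasSum (fun k : ℕ => ‖A * y ^ k‖) (‖A‖ * (1 - ‖y‖)⁻¹) := by
  refine ((hasSum_geometric_of_lt_one (norm_nonneg y) hy).mul_left ‖A‖).congr_fun_aux fun k => ?_
  rw [norm_mul, norm_pow]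

lemma partA_key (x : ℂ) (hx : ‖x‖ < 1 / 2) :
    (Summable fun k : ℕ => ‖∑' n : ℕ, (2 * x / ((n : ℂ) + 1) ^ 2) * ((x / ((n : ℂ) + 1)) ^ 2) ^ k‖) ∧
    HasSum (fun n : ℕ => (2 * x / ((n : ℂ) + 1) ^ 2) * (1 - (x / ((n : ℂ) + 1)) ^ 2)⁻¹)
      (∑' k : ℕ, ∑' n : ℕ, (2 * x / ((n : ℂ) + 1) ^ 2) * ((x / ((n : ℂ) + 1)) ^ 2) ^ k) := by
  have hn1 : ∀ n : ℕ, ‖(n : ℂ) + 1‖ = (n : ℝ) + 1 := by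
    intro n
    have := Complex.norm_natCast (n + 1)
    push_cast at this
    exact this
  have hy : ∀ n : ℕ, ‖(x / ((n : ℂ) + 1)) ^ 2‖ ≤ 1 / 2 := by
    intro n
    rw [norm_pow, norm_div, hn1]
    have : ‖x‖ / ((n : ℝ) + 1) ≤ ‖x‖ := div_le_self (norm_nonneg _) (by linarith [n.cast_nonneg (α := ℝ)])
    have h0 : 0 ≤ ‖x‖ / ((n : ℝ) + 1) := by positivity
    nlinarith
  refine swap_aux (fun n k => (2 * x / ((n : ℂ) + 1) ^ 2) * ((x / ((n : ℂ) + 1)) ^ 2) ^ k)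
    (fun n => (2 * x / ((n : ℂ) + 1) ^ 2) * (1 - (x / ((n : ℂ) + 1)) ^ 2)⁻¹)
    (fun n => ‖2 * x / ((n : ℂ) + 1) ^ 2‖ * (1 - ‖(x / ((n : ℂ) + 1)) ^ 2‖)⁻¹)
    (fun n => 2 * (1 / ((n : ℝ) + 1) ^ 2)) ?_ ?_ ?_ (sq_summable_aux.mul_left 2)
  · intro n
    have h := hy n
    exact geo_aux _ _ (by linarith)
  · intro n
    have h := hy n
    exact geo_norm_aux _ _ (by linarith)
  · intro n
    have h := hy n
    have h1 : ‖2 * x / ((n : ℂ) + 1) ^ 2‖ ≤ 1 / ((n : ℝ) + 1) ^ 2 := by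
      rw [norm_div, norm_pow, hn1, norm_mul]
      gcongr
      simp; linarith
    have h2 : (1 - ‖(x / ((n : ℂ) + 1)) ^ 2‖)⁻¹ ≤ 2 := by
      rw [inv_le_comm₀ (by linarith) (by norm_num)]
      linarith
    have h3 : 0 ≤ (1 - ‖(x / ((n : ℂ) + 1)) ^ 2‖)⁻¹ := inv_nonneg.2 (by linarith)
    calc ‖2 * x / ((n : ℂ) + 1) ^ 2‖ * (1 - ‖(x / ((n : ℂ) + 1)) ^ 2‖)⁻¹
        ≤ (1 / ((n : ℝ) + 1) ^ 2) * 2 := mul_le_mul h1 h2 h3 (by positivity)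
      _ = _ := by ring

lemma partA (x : ℂ) (hx : ‖x‖ < 1 / 2) (hi : 0 < x.im) :
    (Summable fun k : ℕ => ‖2 * x ^ (2 * k + 1) * riemannZeta (2 * (k + 1 : ℕ))‖) ∧
    ∑' k : ℕ, 2 * x ^ (2 * k + 1) * riemannZeta (2 * (k + 1 : ℕ)) =
      -(Real.pi * Complex.cot (Real.pi * x) - 1 / x) := by
  have hz := zeta_term_aux x
  have key := partA_key x hx
  simp only [hz]
  refine ⟨key.1, ?_⟩
  have hmem : x ∈ Complex.integerComplement := UpperHalfPlane.coe_mem_integerComplement ⟨x, hi⟩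
  rw [cot_series_rep' hmem, ← key.2.tsum_eq, ← tsum_neg]
  refine tsum_congr fun n => ?_
  have a1 : (n : ℂ) + 1 ≠ 0 := by exact_mod_cast Nat.succ_ne_zero n
  have a2 : x - ((n : ℂ) + 1) ≠ 0 := by
    intro h
    have := congrArg Complex.im h
    simp at this
    linarith
  have a3 : x + ((n : ℂ) + 1) ≠ 0 := by
    intro h
    have := congrArg Complex.im h
    simp at this
    linarith
  have a4 : (1 - (x / ((n : ℂ) + 1)) ^ 2) = -((x - (n + 1)) * (x + (n + 1))) / (n + 1) ^ 2 := by
    field_simp; ring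
  rw [a4]
  field_simp
  ring

lemma partA' (z : ℂ) (hz : ‖z‖ < 1) (hr : z.re < 0) :
    (Summable fun k : ℕ => ‖2 * riemannZeta (2 * (k + 1 : ℕ)) /
      (2 * Real.pi * Complex.I) ^ (2 * (k + 1)) * z ^ (2 * k + 1)‖) ∧
    HasSum (fun n : ℕ => Complex.exp z ^ (n + 1)) (-z⁻¹ - 1 / 2 +
      ∑' k : ℕ, 2 * riemannZeta (2 * (k + 1 : ℕ)) /
      (2 * Real.pi * Complex.I) ^ (2 * (k + 1)) * z ^ (2 * k + 1)) := by
  have hp : (2 * Real.pi * Complex.I) ≠ 0 := Complex.two_pi_I_ne_zero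
  have hz0 : z ≠ 0 := by rintro rfl; simp at hr
  set x : ℂ := z / (2 * Real.pi * Complex.I) with hx
  have hzx : 2 * Real.pi * Complex.I * x = z := by rw [hx]; field_simp
  have hn : ‖x‖ < 1 / 2 := by
    have : ‖z‖ = 2 * Real.pi * ‖x‖ := by
      rw [← hzx]; simp [abs_of_pos Real.pi_pos]
    have := Real.pi_gt_three
    nlinarith [norm_nonneg x]
  have hi : 0 < x.im := by
    have : z.re = - (2 * Real.pi * x.im) := by
      rw [← hzx]; simp
    have := Real.pi_pos
    by_contra! h
    nlinarith
  have hA := partA x hn hi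
  have hterm : ∀ k : ℕ, 2 * riemannZeta (2 * (k + 1 : ℕ)) /
      (2 * Real.pi * Complex.I) ^ (2 * (k + 1)) * z ^ (2 * k + 1) =
      (2 * Real.pi * Complex.I)⁻¹ * (2 * x ^ (2 * k + 1) * riemannZeta (2 * (k + 1 : ℕ))) := by
    intro k
    rw [hx, div_pow, show 2 * (k + 1) = (2 * k + 1) + 1 by ring, pow_succ _ (2 * k + 1)]
    field_simp
  simp only [hterm]
  constructor
  · simp only [norm_mul (2 * Real.pi * Complex.I : ℂ)⁻¹]
    exact hA.1.mul_left _
  · rw [tsum_mul_left, hA.2]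
    have he : ‖Complex.exp z‖ < 1 := by
      rw [Complex.norm_exp]; rw [Real.exp_lt_one_iff]; exact hr
    have hc := pi_mul_cot_pi_q_exp ⟨x, hi⟩
    simp only [hzx] at hc
    have hg := hasSum_geometric_of_norm_lt_one he
    have h1 := hg.mul_left (Complex.exp z)
    rw [hg.tsum_eq] at hc
    have hne : 1 - Complex.exp z ≠ 0 := by
      intro h
      rw [sub_eq_zero] at h
      rw [← h] at he
      simp at he
    have ef : (fun n : ℕ => Complex.exp z ^ (n + 1)) =
        fun n : ℕ => Complex.exp z * Complex.exp z ^ n := by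
      funext n; ring
    rw [ef]
    refine h1.congr_val_aux ?_
    rw [hc, hx]
    field_simp
    ring

lemma partB (q z : ℂ) (hq1 : ‖q‖ < 1) (hqz : ‖q‖ * Real.exp ‖z‖ < 1) :
    (Summable fun k : ℕ => ‖(2 / ((2 * (k + 1) - 1).factorial : ℂ)) * (∑' n : ℕ,
        ((n : ℂ) + 1) ^ (2 * (k + 1) - 1) * q ^ (n + 1) / (1 - q ^ (n + 1))) * z ^ (2 * k + 1)‖) ∧
    HasSum (fun n : ℕ => (Complex.exp z ^ (n + 1) - Complex.exp z ^ (-((n : ℤ) + 1))) *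
        (q ^ (n + 1) / (1 - q ^ (n + 1))))
      (∑' k : ℕ, (2 / ((2 * (k + 1) - 1).factorial : ℂ)) * (∑' n : ℕ,
        ((n : ℂ) + 1) ^ (2 * (k + 1) - 1) * q ^ (n + 1) / (1 - q ^ (n + 1))) * z ^ (2 * k + 1)) := by
  have hn1 : ∀ n : ℕ, ‖(n : ℂ) + 1‖ = (n : ℝ) + 1 := by
    intro n
    have := Complex.norm_natCast (n + 1)
    push_cast at this
    exact this
  have hterm : ∀ k : ℕ, (2 / ((2 * (k + 1) - 1).factorial : ℂ)) * (∑' n : ℕ,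
        ((n : ℂ) + 1) ^ (2 * (k + 1) - 1) * q ^ (n + 1) / (1 - q ^ (n + 1))) * z ^ (2 * k + 1) =
      ∑' n : ℕ, (2 * (q ^ (n + 1) / (1 - q ^ (n + 1)))) *
        ((((n : ℂ) + 1) * z) ^ (2 * k + 1) / ((2 * k + 1).factorial : ℂ)) := by
    intro k
    rw [← tsum_mul_left, ← tsum_mul_right]
    refine tsum_congr fun n => ?_
    rw [show 2 * (k + 1) - 1 = 2 * k + 1 by omega, mul_pow]
    ring
  simp only [hterm]
  have hS : ∀ n : ℕ, (Complex.exp z ^ (n + 1) - Complex.exp z ^ (-((n : ℤ) + 1))) *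
        (q ^ (n + 1) / (1 - q ^ (n + 1))) =
      (2 * (q ^ (n + 1) / (1 - q ^ (n + 1)))) * Complex.sinh (((n : ℂ) + 1) * z) := by
    intro n
    have e1 : Complex.exp z ^ (n + 1) = Complex.exp (((n : ℂ) + 1) * z) := by
      rw [← Complex.exp_nat_mul]; push_cast; rfl
    have e2 : Complex.exp z ^ (-((n : ℤ) + 1)) = Complex.exp (-(((n : ℂ) + 1) * z)) := by
      rw [← Complex.exp_int_mul]; push_cast; ring_nf
    rw [e1, e2, Complex.sinh]
    ring
  simp only [hS]
  refine swap_aux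
    (fun n k => (2 * (q ^ (n + 1) / (1 - q ^ (n + 1)))) *
        ((((n : ℂ) + 1) * z) ^ (2 * k + 1) / ((2 * k + 1).factorial : ℂ))) _
    (fun n => ‖2 * (q ^ (n + 1) / (1 - q ^ (n + 1)))‖ * Real.sinh (((n : ℝ) + 1) * ‖z‖))
    (fun n => (2 / (1 - ‖q‖)) * (‖q‖ * Real.exp ‖z‖) ^ (n + 1))
    (fun n => (Complex.hasSum_sinh _).mul_left _) (fun n => ?_) (fun n => ?_) ?_
  · have := (Real.hasSum_sinh (((n : ℝ) + 1) * ‖z‖)).mul_left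
      ‖2 * (q ^ (n + 1) / (1 - q ^ (n + 1)))‖
    refine this.congr_fun_aux fun k => ?_
    rw [norm_mul, norm_div _ ((2 * k + 1).factorial : ℂ), norm_pow _ (2 * k + 1), norm_mul _ z, hn1, Complex.norm_natCast]
  · have hs : Real.sinh (((n : ℝ) + 1) * ‖z‖) ≤ Real.exp ‖z‖ ^ (n + 1) := by
      rw [← Real.exp_nat_mul, Real.sinh_eq]
      push_cast
      linarith [Real.exp_pos (((n : ℝ) + 1) * ‖z‖), Real.exp_pos (-(((n : ℝ) + 1) * ‖z‖))]
    have hd : 1 - ‖q‖ ≤ ‖1 - q ^ (n + 1)‖ := by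
      have h1 := norm_sub_norm_le (1 : ℂ) (q ^ (n + 1))
      rw [norm_one, norm_pow] at h1
      have h2 : ‖q‖ ^ (n + 1) ≤ ‖q‖ := pow_le_of_le_one (norm_nonneg _) hq1.le (by omega)
      linarith
    have hd0 : 0 < 1 - ‖q‖ := by linarith
    have hs0 : 0 ≤ Real.sinh (((n : ℝ) + 1) * ‖z‖) := Real.sinh_nonneg_iff.2 (by positivity)
    calc _ = 2 * (‖q‖ ^ (n + 1) / ‖1 - q ^ (n + 1)‖) * Real.sinh (((n : ℝ) + 1) * ‖z‖) := by
            simp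
      _ ≤ 2 * (‖q‖ ^ (n + 1) / (1 - ‖q‖)) * Real.exp ‖z‖ ^ (n + 1) := by gcongr
      _ = _ := by rw [mul_pow]; ring
  · exact ((summable_nat_add_iff 1).2 (summable_geometric_of_lt_one (by positivity) hqz)).mul_left _

/-- The Laurent expansion combining (2.29), (2.30) and (2.32) of the paper: for `τ` in the
upper half-plane and `q = e^{2πiτ}`, there is `δ > 0` such that for all `z` with
`0 < |z| < δ` and `-2π·Im τ < Re z < 0` one has
`P₁(e^z, q) = -z⁻¹ - 1/2 + Σ_{k≥1} E_{2k}(τ)·z^{2k-1}`, the series converging absolutely. -/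
theorem stmt10 (τ : ℂ) (hτ : 0 < τ.im) :
    ∃ δ > 0, ∀ z : ℂ, 0 < ‖z‖ → ‖z‖ < δ →
      -(2 * Real.pi * τ.im) < z.re → z.re < 0 →
      (Summable fun k : ℕ => ‖E2k (k + 1) τ * z ^ (2 * (k + 1) - 1)‖) ∧
      Pk 1 (Complex.exp z) (Complex.exp (2 * Real.pi * Complex.I * τ)) =
        -z⁻¹ - 1 / 2 + ∑' k : ℕ, E2k (k + 1) τ * z ^ (2 * (k + 1) - 1) := by
  set q : ℂ := Complex.exp (2 * Real.pi * Complex.I * τ) with hq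
  have hqn : ‖q‖ = Real.exp (-(2 * Real.pi * τ.im)) := by
    rw [hq, Complex.norm_exp]; simp
  have hpi := Real.pi_pos
  have hpos : 0 < 2 * Real.pi * τ.im := by positivity
  refine ⟨min 1 (2 * Real.pi * τ.im), lt_min one_pos hpos, ?_⟩
  intro z hz0 hzδ _ hzr
  have hz1 : ‖z‖ < 1 := hzδ.trans_le (min_le_left _ _)
  have hz2 : ‖z‖ < 2 * Real.pi * τ.im := hzδ.trans_le (min_le_right _ _)
  have hq1 : ‖q‖ < 1 := by rw [hqn, Real.exp_lt_one_iff]; linarith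
  have hqz : ‖q‖ * Real.exp ‖z‖ < 1 := by
    rw [hqn, ← Real.exp_add, Real.exp_lt_one_iff]; linarith
  obtain ⟨hA1, hA2⟩ := partA' z hz1 hzr
  obtain ⟨hB1, hB2⟩ := partB q z hq1 hqz
  have hE : ∀ k : ℕ, E2k (k + 1) τ * z ^ (2 * (k + 1) - 1) =
      2 * riemannZeta (2 * (k + 1 : ℕ)) /
      (2 * Real.pi * Complex.I) ^ (2 * (k + 1)) * z ^ (2 * k + 1) +
      (2 / ((2 * (k + 1) - 1).factorial : ℂ)) * (∑' n : ℕ,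
        ((n : ℂ) + 1) ^ (2 * (k + 1) - 1) * q ^ (n + 1) / (1 - q ^ (n + 1))) * z ^ (2 * k + 1) := by
    intro k
    rw [E2k, ← hq, show 2 * (k + 1) - 1 = 2 * k + 1 by omega]
    split_ifs with h
    · obtain rfl : k = 0 := by omega
      have : 2 * riemannZeta (2 * ((0 + 1 : ℕ) : ℂ)) / (2 * Real.pi * Complex.I) ^ (2 * (0 + 1)) =
          -1 / 12 := by
        have hp : (Real.pi : ℂ) ≠ 0 := by exact_mod_cast hpi.ne'
        norm_num [riemannZeta_two, mul_pow]
        field_simp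
        norm_num
      rw [this]
      simp
      ring
    · ring
  simp only [hE]
  constructor
  · exact Summable.of_nonneg_of_le (fun _ => norm_nonneg _) (fun k => norm_add_le _ _) (hA1.add hB1)
  · rw [(hA1.of_norm).tsum_add hB1.of_norm, ← add_assoc, ← (hA2.add hB2).tsum_eq, Pk]
    simp only [Nat.sub_self, Nat.factorial_zero, Nat.cast_one, inv_one, one_mul, pow_zero, pow_one]
    refine tsum_congr fun n => ?_
    have hne : 1 - q ^ (n + 1) ≠ 0 := by
      intro h
      rw [sub_eq_zero] at h
      have h2 : ‖q ^ (n + 1)‖ < 1 := by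
        rw [norm_pow]; exact pow_lt_one₀ (norm_nonneg _) hq1 (by omega)
      rw [← h] at h2
      simp at h2
    field_simp
    ring
end

section
/- Let τ lie in the complex upper half-plane, set q = e^{2πiτ}, and let k ≥ 3 be an integer. There exists δ > 0 (depending on τ) such that for every z ∈ ℂ with 0 < |z| < δ and −2π·Im τ < Re z < 0 (so that |q| < |e^z| < 1 and P_k(e^z,q) is defined), one has P_k(e^z, q) = (−1)^k·z^{−k} + Σ_{n=1}^{∞} binom(2n+1, k−1)·E_{2n+2}(τ)·z^{2n+2−k}, with the series on the right converging absolutely (here binom(2n+1,k−1) is the ordinary binomial coefficient, equal to 0 when k−1 > 2n+1). -/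
open Complex

lemma aux_swap (F : ℕ → ℕ → ℂ) (f : ℕ → ℂ) (B : ℕ → ℕ → ℝ) (b : ℕ → ℝ)
    (hF : ∀ n, HasSum (F n) (f n)) (hB : ∀ n j, ‖F n j‖ ≤ B n j)
    (hb : ∀ n, HasSum (B n) (b n)) (hs : Summable b) :
    Summable f ∧ HasSum (fun j => ∑' n, F n j) (∑' n, f n) := by
  have h0 : Summable (fun p : ℕ × ℕ => B p.1 p.2) := by
    rw [summable_prod_of_nonneg]
    · refine ⟨fun n => (hb n).summable, ?_⟩
      simpa only [(hb _).tsum_eq] using hs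
    · intro p
      exact (norm_nonneg _).trans (hB p.1 p.2)
  have h1 : Summable (fun p : ℕ × ℕ => F p.1 p.2) :=
    Summable.of_norm_bounded h0 (fun p => hB p.1 p.2)
  have h2 : HasSum f (∑' p : ℕ × ℕ, F p.1 p.2) := h1.hasSum.prod_fiberwise hF
  refine ⟨h2.summable, ?_⟩
  rw [h2.tsum_eq]
  have h3 : Summable (fun p : ℕ × ℕ => F p.2 p.1) := h1.prod_symm
  have h4 : HasSum (fun p : ℕ × ℕ => F p.2 p.1) (∑' p : ℕ × ℕ, F p.1 p.2) :=
    (Equiv.prodComm ℕ ℕ).hasSum_iff.2 h1.hasSum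
  exact h4.prod_fiberwise (fun j => (h3.prod_factor j).hasSum)

lemma aux_zeta (K : ℕ) (hK : 1 ≤ K) (z c : ℂ) (hz : ‖z‖ < 1) (hc : 1 ≤ ‖c‖) :
    Summable (fun n : ℕ => 1 / (z + c * ((n : ℂ) + 1)) ^ (K + 1)) ∧
    HasSum (fun j : ℕ => ∑' n : ℕ, (((j + K).choose K : ℕ) : ℂ) * (-z) ^ j *
        (1 / (c * ((n : ℂ) + 1)) ^ (K + 1 + j)))
      (∑' n : ℕ, 1 / (z + c * ((n : ℂ) + 1)) ^ (K + 1)) := by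
  have hN : ∀ n : ℕ, ‖(n : ℂ) + 1‖ = (n : ℝ) + 1 := by
    intro n
    rw [← Nat.cast_add_one, Complex.norm_natCast]; push_cast; rfl
  have hcN : ∀ n : ℕ, (n : ℝ) + 1 ≤ ‖c * ((n : ℂ) + 1)‖ := by
    intro n
    rw [norm_mul, hN]
    have : (0 : ℝ) ≤ n := n.cast_nonneg
    nlinarith
  have hcN1 : ∀ n : ℕ, 1 ≤ ‖c * ((n : ℂ) + 1)‖ := by
    intro n
    have : (0 : ℝ) ≤ n := n.cast_nonneg
    linarith [hcN n]
  apply aux_swap _ _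
    (fun n j => (1 / ((n : ℝ) + 1) ^ (K + 1)) * ((((j + K).choose K : ℕ) : ℝ) * ‖z‖ ^ j))
    (fun n => (1 / ((n : ℝ) + 1) ^ (K + 1)) * (1 / (1 - ‖z‖) ^ (K + 1)))
  · intro n
    set a := c * ((n : ℂ) + 1) with ha
    have ha1 : 1 ≤ ‖a‖ := hcN1 n
    have ha0 : a ≠ 0 := by
      intro h; rw [h, norm_zero] at ha1; linarith
    have hr : ‖-z / a‖ < 1 := by
      rw [norm_div, norm_neg, div_lt_one (by linarith)]; linarith
    have := (hasSum_choose_mul_geometric_of_norm_lt_one K hr).mul_left (1 / a ^ (K + 1))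
    convert! this using 1
    · funext j
      rw [div_pow, pow_add a (K + 1) j]
      field_simp
    · rw [one_div_mul_one_div, ← mul_pow]
      congr 2
      field_simp
      ring
  · intro n j
    rw [norm_mul, norm_mul, norm_pow, norm_neg, Complex.norm_natCast, norm_div, norm_one, norm_pow,
      mul_comm]
    gcongr
    calc ((n : ℝ) + 1) ^ (K + 1) ≤ ‖c * ((n : ℂ) + 1)‖ ^ (K + 1) := by
          gcongr; exact hcN n
      _ ≤ _ := pow_le_pow_right₀ (hcN1 n) (by omega)
  · intro n
    have hr : ‖‖z‖‖ < 1 := by simpa using hz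
    exact (hasSum_choose_mul_geometric_of_norm_lt_one K hr).mul_left _
  · apply Summable.mul_right
    have := (summable_nat_add_iff 1).2
      (Real.summable_one_div_nat_pow (p := K + 1) |>.2 (by omega))
    simpa using this

lemma aux_geom (K : ℕ) (x : ℝ) (hx0 : 0 ≤ x) (hx : x < 1) :
    Summable (fun n : ℕ => ((n : ℝ) + 1) ^ K * x ^ (n + 1)) := by
  have h := summable_pow_mul_geometric_of_norm_lt_one (R := ℝ) K (r := x)
    (by rwa [Real.norm_of_nonneg hx0])
  simpa using (summable_nat_add_iff 1).2 h

lemma aux_q (K : ℕ) (z q : ℂ) (hq : ‖q‖ * Real.exp ‖z‖ < 1) :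
    Summable (fun n : ℕ => ((n : ℂ) + 1) ^ K * (q ^ (n + 1) / (1 - q ^ (n + 1))) *
      (cexp (((n : ℂ) + 1) * z) + (-1) ^ (K + 1) * cexp (-(((n : ℂ) + 1) * z)))) ∧
    HasSum (fun j : ℕ => ∑' n : ℕ, ((n : ℂ) + 1) ^ K * (q ^ (n + 1) / (1 - q ^ (n + 1))) *
      ((((n : ℂ) + 1) * z) ^ j / (j.factorial : ℂ) +
        (-1) ^ (K + 1) * ((-(((n : ℂ) + 1) * z)) ^ j / (j.factorial : ℂ))))
      (∑' n : ℕ, ((n : ℂ) + 1) ^ K * (q ^ (n + 1) / (1 - q ^ (n + 1))) *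
      (cexp (((n : ℂ) + 1) * z) + (-1) ^ (K + 1) * cexp (-(((n : ℂ) + 1) * z)))) := by
  have hN : ∀ n : ℕ, ‖(n : ℂ) + 1‖ = (n : ℝ) + 1 := by
    intro n
    rw [← Nat.cast_add_one, Complex.norm_natCast]; push_cast; rfl
  have hexp : ∀ w : ℂ, HasSum (fun j : ℕ => w ^ j / (j.factorial : ℂ)) (cexp w) := by
    intro w
    rw [Complex.exp_eq_exp_ℂ]
    exact NormedSpace.expSeries_div_hasSum_exp w
  have hexpR : ∀ w : ℝ, HasSum (fun j : ℕ => w ^ j / (j.factorial : ℝ)) (Real.exp w) := by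
    intro w
    rw [Real.exp_eq_exp_ℝ]
    exact NormedSpace.expSeries_div_hasSum_exp w
  have hq1 : ‖q‖ < 1 := by
    have : 1 ≤ Real.exp ‖z‖ := Real.one_le_exp (norm_nonneg _)
    nlinarith [norm_nonneg q]
  have hr : ∀ n : ℕ, ‖q ^ (n + 1) / (1 - q ^ (n + 1))‖ ≤ ‖q‖ ^ (n + 1) / (1 - ‖q‖) := by
    intro n
    rw [norm_div, norm_pow]
    have h1 : 1 - ‖q‖ ≤ ‖1 - q ^ (n + 1)‖ := by
      have h2 := norm_sub_norm_le (1 : ℂ) (q ^ (n + 1))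
      rw [norm_one, norm_pow] at h2
      have h3 : ‖q‖ ^ (n + 1) ≤ ‖q‖ := pow_le_of_le_one (norm_nonneg _) hq1.le (by omega)
      linarith
    have : 0 < 1 - ‖q‖ := by linarith
    gcongr
  apply aux_swap _ _
    (fun n j => ((n : ℝ) + 1) ^ K * (‖q‖ ^ (n + 1) / (1 - ‖q‖)) *
      (2 * ((((n : ℝ) + 1) * ‖z‖) ^ j / (j.factorial : ℝ))))
    (fun n => ((n : ℝ) + 1) ^ K * (‖q‖ ^ (n + 1) / (1 - ‖q‖)) *
      (2 * Real.exp (((n : ℝ) + 1) * ‖z‖)))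
  · intro n
    exact ((hexp _).add ((hexp _).mul_left _)).mul_left _
  · intro n j
    rw [norm_mul, norm_mul, norm_pow, hN]
    have : 0 < 1 - ‖q‖ := by linarith
    gcongr
    · exact hr n
    · refine (norm_add_le _ _).trans (le_of_eq ?_)
      simp only [norm_mul, norm_div, norm_pow, norm_neg, norm_one, one_pow, hN,
        Complex.norm_natCast]
      ring
  · intro n
    exact ((hexpR _).mul_left _).mul_left _
  · have := (aux_geom K (‖q‖ * Real.exp ‖z‖) (by positivity) hq).mul_left (2 / (1 - ‖q‖))
    refine this.congr (fun n => ?_)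
    rw [mul_pow, ← Real.exp_nat_mul]
    push_cast
    ring

lemma aux_lip (K : ℕ) (hK : 1 ≤ K) (z : ℂ) (hz : z.re < 0) (hz1 : ‖z‖ < 1) :
    ((K.factorial : ℂ))⁻¹ * ∑' n : ℕ, ((n : ℂ) + 1) ^ K * cexp z ^ (n + 1) =
      (-1) ^ (K + 1) * (1 / z ^ (K + 1) +
        ((∑' n : ℕ, 1 / (z + (2 * Real.pi * I) * ((n : ℂ) + 1)) ^ (K + 1)) +
        ∑' n : ℕ, 1 / (z + (-(2 * Real.pi * I)) * ((n : ℂ) + 1)) ^ (K + 1))) := by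
  have hpi : (2 * Real.pi * I : ℂ) ≠ 0 := by simp [Real.pi_ne_zero]
  have hc : 1 ≤ ‖(2 * Real.pi * I : ℂ)‖ := by
    simp only [norm_mul, Complex.norm_I, Complex.norm_real, Complex.norm_ofNat,
      Real.norm_of_nonneg Real.pi_pos.le]
    linarith [Real.pi_gt_three]
  set w : ℂ := z / (2 * Real.pi * I) with hw
  have hwz : (2 * Real.pi * I) * w = z := by rw [hw]; field_simp
  have hwim : 0 < w.im := by
    have h1 := congrArg Complex.re hwz
    simp at h1
    have := Real.pi_pos
    nlinarith
  have key := EisensteinSeries.qExpansion_identity hK ⟨w, hwim⟩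
  have hs1 := (aux_zeta K hK z _ hz1 hc).1
  have hs2 := (aux_zeta K hK z (-(2 * Real.pi * I)) hz1 (by rwa [norm_neg])).1
  have hint := HasSum.of_add_one_of_neg_add_one
    (f := fun m : ℤ => 1 / (z + (2 * Real.pi * I) * (m : ℂ)) ^ (K + 1))
    (m := ∑' n : ℕ, 1 / (z + (2 * Real.pi * I) * ((n : ℂ) + 1)) ^ (K + 1))
    (m' := ∑' n : ℕ, 1 / (z + (-(2 * Real.pi * I)) * ((n : ℂ) + 1)) ^ (K + 1))
    (by
      convert! hs1.hasSum using 2 with n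
      push_cast
      rfl)
    (by
      convert! hs2.hasSum using 2 with n
      push_cast
      rw [neg_mul, mul_neg])
  have h2 : ∑' n : ℤ, 1 / (w + n) ^ (K + 1) =
      (2 * Real.pi * I) ^ (K + 1) *
        ∑' m : ℤ, 1 / (z + (2 * Real.pi * I) * (m : ℂ)) ^ (K + 1) := by
    rw [← tsum_mul_left]
    refine tsum_congr (fun m => ?_)
    rw [← hwz, ← mul_add, mul_pow _ (w + (m : ℂ)), one_div, one_div, mul_inv, mul_inv_cancel_left₀ (pow_ne_zero _ hpi)]
  have h3 : ∑' n : ℕ, (n : ℂ) ^ K * cexp z ^ n =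
      ∑' n : ℕ, ((n : ℂ) + 1) ^ K * cexp z ^ (n + 1) := by
    have hsum : Summable (fun n : ℕ => (n : ℂ) ^ K * cexp z ^ n) := by
      apply summable_pow_mul_geometric_of_norm_lt_one
      rw [Complex.norm_exp]
      exact Real.exp_zero ▸ Real.exp_lt_exp.2 hz
    rw [hsum.tsum_eq_zero_add]
    have : K ≠ 0 := by omega
    simp [this]
  rw [hwz, h2, hint.tsum_eq, h3] at key
  have e : (-2 * Real.pi * I : ℂ) ^ (K + 1) = (-1) ^ (K + 1) * (2 * Real.pi * I) ^ (K + 1) := by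
    rw [← mul_pow]; ring
  rw [e] at key
  have e2 : ((-1 : ℂ) ^ (K + 1)) * (-1) ^ (K + 1) = 1 := by
    rw [← mul_pow]; simp
  have hp : (2 * Real.pi * I : ℂ) ^ (K + 1) ≠ 0 := pow_ne_zero _ hpi
  apply mul_left_cancel₀ hp
  simp only [Int.cast_zero, mul_zero, add_zero] at key
  generalize (∑' n : ℕ, ((n : ℂ) + 1) ^ K * cexp z ^ (n + 1)) = T at key ⊢
  generalize (∑' n : ℕ, 1 / (z + (2 * Real.pi * I) * ((n : ℂ) + 1)) ^ (K + 1)) = A at key ⊢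
  generalize (∑' n : ℕ, 1 / (z + (-(2 * Real.pi * I)) * ((n : ℂ) + 1)) ^ (K + 1)) = B at key ⊢
  linear_combination (-(-1 : ℂ) ^ (K + 1)) * key - (2 * Real.pi * I : ℂ) ^ (K + 1) * ((K.factorial : ℂ))⁻¹ * T * e2

lemma aux_coef (K j : ℕ) (z q : ℂ) (hz : z ≠ 0) :
    (((K.factorial : ℂ))⁻¹ * ∑' n : ℕ, ((n : ℂ) + 1) ^ K * (q ^ (n + 1) / (1 - q ^ (n + 1))) *
      ((((n : ℂ) + 1) * z) ^ j / (j.factorial : ℂ) +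
        (-1) ^ (K + 1) * ((-(((n : ℂ) + 1) * z)) ^ j / (j.factorial : ℂ)))) +
    (-1) ^ (K + 1) *
      ((∑' n : ℕ, (((j + K).choose K : ℕ) : ℂ) * (-z) ^ j *
        (1 / ((2 * Real.pi * I) * ((n : ℂ) + 1)) ^ (K + 1 + j))) +
      ∑' n : ℕ, (((j + K).choose K : ℕ) : ℂ) * (-z) ^ j *
        (1 / ((-(2 * Real.pi * I)) * ((n : ℂ) + 1)) ^ (K + 1 + j))) =
    (((j + (K + 1) - 1).choose K : ℕ) : ℂ) * (1 + (-1) ^ (j + (K + 1))) *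
      ((∑' n : ℕ, 1 / ((n : ℂ) + 1) ^ (j + (K + 1))) / (2 * Real.pi * I) ^ (j + (K + 1)) +
        (∑' n : ℕ, ((n : ℂ) + 1) ^ (j + (K + 1) - 1) * q ^ (n + 1) / (1 - q ^ (n + 1))) /
          ((j + (K + 1) - 1).factorial : ℂ)) * z ^ (((j + (K + 1) : ℕ) : ℤ) - ((K + 1 : ℕ) : ℤ)) := by
  have e0 : ((j + (K + 1) : ℕ) : ℤ) - ((K + 1 : ℕ) : ℤ) = (j : ℤ) := by push_cast; ring
  rw [e0, zpow_natCast, show j + (K + 1) - 1 = j + K by omega]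
  have e1 : ∑' n : ℕ, ((n : ℂ) + 1) ^ K * (q ^ (n + 1) / (1 - q ^ (n + 1))) *
      ((((n : ℂ) + 1) * z) ^ j / (j.factorial : ℂ) +
        (-1) ^ (K + 1) * ((-(((n : ℂ) + 1) * z)) ^ j / (j.factorial : ℂ))) =
      ((1 + (-1) ^ (j + (K + 1))) * z ^ j / (j.factorial : ℂ)) *
        ∑' n : ℕ, ((n : ℂ) + 1) ^ (j + K) * q ^ (n + 1) / (1 - q ^ (n + 1)) := by
    rw [← tsum_mul_left]
    refine tsum_congr (fun n => ?_)
    rw [neg_pow (((n : ℂ) + 1) * z), mul_pow]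
    ring
  have e2 : ∀ c : ℂ, ∑' n : ℕ, (((j + K).choose K : ℕ) : ℂ) * (-z) ^ j *
        (1 / (c * ((n : ℂ) + 1)) ^ (K + 1 + j)) =
      ((((j + K).choose K : ℕ) : ℂ) * (-z) ^ j * (c ^ (j + (K + 1)))⁻¹) *
        ∑' n : ℕ, 1 / ((n : ℂ) + 1) ^ (j + (K + 1)) := by
    intro c
    rw [← tsum_mul_left]
    refine tsum_congr (fun n => ?_)
    rw [mul_pow, show K + 1 + j = j + (K + 1) by omega, one_div, mul_inv, one_div, mul_assoc, mul_assoc,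
      mul_assoc]
  rw [e1, e2, e2]
  have e3 : ((-(2 * Real.pi * I : ℂ)) ^ (j + (K + 1)))⁻¹ =
      (-1) ^ (j + (K + 1)) * ((2 * Real.pi * I : ℂ) ^ (j + (K + 1)))⁻¹ := by
    rw [neg_pow, mul_inv, ← inv_pow]; norm_num
  have e4 : (((j + K).choose K : ℕ) : ℂ) =
      ((j + K).factorial : ℂ) * ((K.factorial : ℂ))⁻¹ * ((j.factorial : ℂ))⁻¹ := by
    have h1 : ((j.factorial : ℂ)) ≠ 0 := by exact_mod_cast j.factorial_ne_zero
    have h2 : ((K.factorial : ℂ)) ≠ 0 := by exact_mod_cast K.factorial_ne_zero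
    have := Nat.add_choose_mul_factorial_mul_factorial K j
    rw [Nat.add_comm K j] at this
    rw [← this]
    push_cast
    field_simp
    try rw [Nat.choose_symm_add]
  have e5 : ((-1 : ℂ) ^ (j + (K + 1))) * (-1) ^ (j + (K + 1)) = 1 := by
    rw [← mul_pow]; simp
  have h3 : (((j + K).factorial : ℂ)) ≠ 0 := by exact_mod_cast (j + K).factorial_ne_zero
  have e6 : (((j + K).choose K : ℕ) : ℂ) * (((j + K).factorial : ℂ))⁻¹ =
      ((K.factorial : ℂ))⁻¹ * ((j.factorial : ℂ))⁻¹ := by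
    rw [e4]; field_simp
  rw [e3, neg_pow z]
  have e7 : (-1 : ℂ) ^ (K + 1) * (-1) ^ j = (-1) ^ (j + (K + 1)) := by ring
  generalize (∑' n : ℕ, 1 / ((n : ℂ) + 1) ^ (j + (K + 1))) = Z
  generalize (∑' n : ℕ, ((n : ℂ) + 1) ^ (j + K) * q ^ (n + 1) / (1 - q ^ (n + 1))) = S
  generalize ((2 * Real.pi * I : ℂ) ^ (j + (K + 1))) = D
  generalize hs : (-1 : ℂ) ^ (j + (K + 1)) = s at *
  generalize (-1 : ℂ) ^ (K + 1) = u at *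
  generalize (-1 : ℂ) ^ j = v at *
  generalize (((j + K).choose K : ℕ) : ℂ) = C at *
  simp only [div_eq_mul_inv]
  linear_combination (-(1 + s) * S * z ^ j) * e6 + (C * z ^ j * D⁻¹ * Z * (1 + s)) * e7 +
    (C * z ^ j * D⁻¹ * Z) * e5

/-- The Laurent expansion combining (2.29) and (2.34) of the paper: for `τ` in the upper
half-plane, `q = e^{2πiτ}` and an integer `k ≥ 3`, there is `δ > 0` such that for all
`z` with `0 < |z| < δ` and `-2π·Im τ < Re z < 0` one has
`P_k(e^z, q) = (-1)^k·z^{-k} + Σ_{n≥1} binom(2n+1, k-1)·E_{2n+2}(τ)·z^{2n+2-k}`, the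
series converging absolutely (with `binom(2n+1,k-1) = 0` when `k-1 > 2n+1`). -/
theorem stmt12 (τ : ℂ) (hτ : 0 < τ.im) (k : ℕ) (hk : 3 ≤ k) :
    ∃ δ > 0, ∀ z : ℂ, 0 < ‖z‖ → ‖z‖ < δ →
      -(2 * Real.pi * τ.im) < z.re → z.re < 0 →
      (Summable fun n : ℕ =>
        ‖((2 * (n + 1) + 1).choose (k - 1) : ℂ) * E2k (n + 2) τ *
          z ^ (2 * ((n : ℤ) + 1) + 2 - (k : ℤ))‖) ∧
      Pk k (Complex.exp z) (Complex.exp (2 * Real.pi * Complex.I * τ)) =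
        (-1 : ℂ) ^ k * z ^ (-(k : ℤ)) +
          ∑' n : ℕ, ((2 * (n + 1) + 1).choose (k - 1) : ℂ) * E2k (n + 2) τ *
            z ^ (2 * ((n : ℤ) + 1) + 2 - (k : ℤ)) := by
  obtain ⟨K, rfl⟩ : ∃ K, k = K + 1 := ⟨k - 1, by omega⟩
  have hK : 2 ≤ K := by omega
  refine ⟨min 1 (2 * Real.pi * τ.im), by have := Real.pi_pos; positivity, ?_⟩
  intro z hz0 hzδ _ hzre
  have hz1 : ‖z‖ < 1 := hzδ.trans_le (min_le_left _ _)
  have hz2 : ‖z‖ < 2 * Real.pi * τ.im := hzδ.trans_le (min_le_right _ _)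
  have hzne : z ≠ 0 := norm_pos_iff.1 hz0
  set q : ℂ := Complex.exp (2 * Real.pi * Complex.I * τ) with hqdef
  have hqn : ‖q‖ = Real.exp (-(2 * Real.pi * τ.im)) := by
    rw [hqdef, Complex.norm_exp]
    congr 1
    simp
  have hq : ‖q‖ * Real.exp ‖z‖ < 1 := by
    rw [hqn, ← Real.exp_add, ← Real.exp_zero]
    exact Real.exp_lt_exp.2 (by linarith)
  have hq1 : ‖q‖ < 1 := by
    have : 1 ≤ Real.exp ‖z‖ := Real.one_le_exp (norm_nonneg _)
    nlinarith [norm_nonneg q]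
  have hqN : ∀ n : ℕ, 1 - q ^ (n + 1) ≠ 0 := by
    intro n h
    have h1 : q ^ (n + 1) = 1 := by linear_combination -h
    have h2 : ‖q‖ ^ (n + 1) = 1 := by rw [← norm_pow, h1, norm_one]
    have h3 : ‖q‖ ^ (n + 1) < 1 := pow_lt_one₀ (norm_nonneg _) hq1 (by omega)
    linarith
  have hc : 1 ≤ ‖(2 * Real.pi * I : ℂ)‖ := by
    simp only [norm_mul, Complex.norm_I, Complex.norm_real, Complex.norm_ofNat,
      Real.norm_of_nonneg Real.pi_pos.le]
    linarith [Real.pi_gt_three]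
  obtain ⟨hqs, hqh⟩ := aux_q K z q hq
  obtain ⟨_, hp⟩ := aux_zeta K (by omega) z _ hz1 hc
  obtain ⟨_, hm⟩ := aux_zeta K (by omega) z (-(2 * Real.pi * I)) hz1 (by rwa [norm_neg])
  have hlip := aux_lip K (by omega) z hzre hz1
  have hall := (hqh.mul_left ((K.factorial : ℂ))⁻¹).add ((hp.add hm).mul_left ((-1) ^ (K + 1)))
  have hgs : Summable (fun n : ℕ => ((n : ℂ) + 1) ^ K * cexp z ^ (n + 1)) := by
    have h := summable_pow_mul_geometric_of_norm_lt_one (R := ℂ) K (r := cexp z)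
      (by rw [Complex.norm_exp]; exact Real.exp_zero ▸ Real.exp_lt_exp.2 hzre)
    simpa using (summable_nat_add_iff 1).2 h
  -- the left-hand side
  have hP : Pk (K + 1) (cexp z) q = (-1) ^ (K + 1) * z ^ (-((K + 1 : ℕ) : ℤ)) +
      (((K.factorial : ℂ))⁻¹ *
        (∑' n : ℕ, ((n : ℂ) + 1) ^ K * (q ^ (n + 1) / (1 - q ^ (n + 1))) *
          (cexp (((n : ℂ) + 1) * z) + (-1) ^ (K + 1) * cexp (-(((n : ℂ) + 1) * z)))) +
        (-1) ^ (K + 1) *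
        ((∑' n : ℕ, 1 / (z + (2 * Real.pi * I) * ((n : ℂ) + 1)) ^ (K + 1)) +
        ∑' n : ℕ, 1 / (z + (-(2 * Real.pi * I)) * ((n : ℂ) + 1)) ^ (K + 1))) := by
    have h1 : Pk (K + 1) (cexp z) q = ((K.factorial : ℂ))⁻¹ *
        ∑' n : ℕ, (((n : ℂ) + 1) ^ K * cexp z ^ (n + 1) +
          ((n : ℂ) + 1) ^ K * (q ^ (n + 1) / (1 - q ^ (n + 1))) *
          (cexp (((n : ℂ) + 1) * z) + (-1) ^ (K + 1) * cexp (-(((n : ℂ) + 1) * z)))) := by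
      unfold Pk
      rw [Nat.add_sub_cancel]
      congr 1
      refine tsum_congr (fun n => ?_)
      have e1 : cexp z ^ (n + 1) = cexp (((n : ℂ) + 1) * z) := by
        rw [← Complex.exp_nat_mul]; push_cast; rfl
      have e2 : cexp z ^ (-((n : ℤ) + 1)) = cexp (-(((n : ℂ) + 1) * z)) := by
        rw [zpow_neg, Complex.exp_neg, ← e1]
        norm_cast
      rw [e1, e2]
      have := hqN n
      field_simp
      ring
    rw [h1, hgs.tsum_add hqs, mul_add, hlip, zpow_neg, zpow_natCast]
    ring
  set H : ℕ → ℂ := fun p => (((p - 1).choose K : ℕ) : ℂ) * (1 + (-1) ^ p) *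
      ((∑' n : ℕ, 1 / ((n : ℂ) + 1) ^ p) / (2 * Real.pi * I) ^ p +
        (∑' n : ℕ, ((n : ℂ) + 1) ^ (p - 1) * q ^ (n + 1) / (1 - q ^ (n + 1))) /
          ((p - 1).factorial : ℂ)) * z ^ ((p : ℤ) - ((K + 1 : ℕ) : ℤ)) with hH
  have hG := hall
  have hGe : ∀ j, _ = H (j + (K + 1)) := fun j => aux_coef K j z q hzne
  simp only [hGe] at hG
  have hsmall : ∀ p, p < K + 1 → H p = 0 := by
    intro p hp
    have : (p - 1).choose K = 0 := Nat.choose_eq_zero_of_lt (by omega)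
    simp [hH, this]
  have hH1 := (Function.Injective.hasSum_iff (f := H) (g := fun j => j + (K + 1))
    (add_left_injective _) (by
      intro p hp
      apply hsmall
      by_contra h
      exact hp ⟨p - (K + 1), by simp only; omega⟩)).1 hG
  have hH2 := (Function.Injective.hasSum_iff (f := H) (g := fun n => 2 * n + 4)
    (fun a b h => by simp only at h; omega) (by
      intro p hp
      rcases Nat.even_or_odd p with he | ho
      · apply hsmall
        obtain ⟨r, hr⟩ := he
        by_contra h
        exact hp ⟨r - 2, by simp only; omega⟩
      · simp [hH, ho.neg_one_pow])).2 hH1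
  have hterm : ∀ n : ℕ, H (2 * n + 4) =
      ((2 * (n + 1) + 1).choose (K + 1 - 1) : ℂ) * E2k (n + 2) τ *
          z ^ (2 * ((n : ℤ) + 1) + 2 - ((K + 1 : ℕ) : ℤ)) := by
    intro n
    have hz : riemannZeta (2 * ((n + 2 : ℕ) : ℂ)) =
        ∑' m : ℕ, 1 / ((m : ℂ) + 1) ^ (2 * n + 4) := by
      have h1 : (2 * ((n + 2 : ℕ) : ℂ)) = ((2 * n + 4 : ℕ) : ℂ) := by push_cast; ring
      rw [h1, zeta_eq_tsum_one_div_nat_add_one_cpow]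
      · simp only [Complex.cpow_natCast]
      · rw [Complex.natCast_re]
        norm_cast
        omega
    have hev : (-1 : ℂ) ^ (2 * n + 4) = 1 := Even.neg_one_pow ⟨n + 2, by ring⟩
    simp only [hH, E2k]
    rw [if_neg (by omega), hz, ← hqdef, hev]
    rw [show 2 * n + 4 - 1 = 2 * (n + 1) + 1 by omega, show 2 * (n + 2) = 2 * n + 4 by ring,
      show 2 * n + 4 - 1 = 2 * (n + 1) + 1 by omega, Nat.add_sub_cancel,
      show (((2 * n + 4 : ℕ) : ℤ)) = 2 * ((n : ℤ) + 1) + 2 by push_cast; ring]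
    ring
  have hfin := hH2
  simp only [Function.comp_def, hterm] at hfin
  exact ⟨hfin.summable.norm, by rw [hfin.tsum_eq]; exact hP⟩
end

section
/- Let E₂(τ) = −1/12 + 2 Σ_{n≥1} n·qⁿ/(1−qⁿ) with q = e^{2πiτ}, for τ in the complex upper half-plane. Then for every matrix (a b; c d) ∈ SL(2,ℤ) and every τ in the upper half-plane, E₂((aτ+b)/(cτ+d)) = (cτ+d)²·E₂(τ) − c·(cτ+d)/(2πi). -/
/-- The normalized weight-2 Eisenstein series
`E₂(τ) = -1/12 + 2 Σ_{n≥1} n·qⁿ/(1-qⁿ)` with `q = e^{2πiτ}`. -/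
noncomputable def E2 (τ : ℂ) : ℂ :=
  -1 / 12 + 2 * ∑' n : ℕ,
    ((n : ℂ) + 1) * Complex.exp (2 * Real.pi * Complex.I * τ) ^ (n + 1) /
      (1 - Complex.exp (2 * Real.pi * Complex.I * τ) ^ (n + 1))

open UpperHalfPlane in
lemma E2_eq_G2 (z : ℍ) : E2 (z : ℂ) = -(EisensteinSeries.G2 z) / (4 * (Real.pi : ℂ) ^ 2) := by
  have hpi : (Real.pi : ℂ) ≠ 0 := by exact_mod_cast Real.pi_ne_zero
  have h := tsum_pow_div_one_sub_eq_tsum_sigma (norm_exp_two_pi_I_lt_one z) 1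
  rw [EisensteinSeries.G2_eq_tsum_cexp, riemannZeta_two]
  have h2 : ∑' n : ℕ, ((n : ℂ) + 1) * Complex.exp (2 * Real.pi * Complex.I * z) ^ (n + 1) /
      (1 - Complex.exp (2 * Real.pi * Complex.I * z) ^ (n + 1)) =
      ∑' n : ℕ+, (ArithmeticFunction.sigma 1 n : ℂ) *
        Complex.exp (2 * Real.pi * Complex.I * z) ^ (n : ℕ) := by
    rw [← h, tsum_pnat_eq_tsum_succ (f := fun n : ℕ => (n : ℂ) ^ 1 *
      Complex.exp (2 * Real.pi * Complex.I * z) ^ n /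
      (1 - Complex.exp (2 * Real.pi * Complex.I * z) ^ n))]
    simp
  rw [E2, h2]
  field_simp
  ring

/-- The quasi-modular transformation law (2.25) of the paper: for every
`γ = (a b; c d) ∈ SL(2,ℤ)` and `τ` in the upper half-plane,
`E₂((aτ+b)/(cτ+d)) = (cτ+d)²·E₂(τ) - c·(cτ+d)/(2πi)`. -/
theorem stmt13 (γ : Matrix.SpecialLinearGroup (Fin 2) ℤ) (τ : ℂ) (hτ : 0 < τ.im) :
    E2 (((γ 0 0 : ℤ) * τ + (γ 0 1 : ℤ)) / ((γ 1 0 : ℤ) * τ + (γ 1 1 : ℤ))) =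
      ((γ 1 0 : ℤ) * τ + (γ 1 1 : ℤ)) ^ 2 * E2 τ -
        (γ 1 0 : ℤ) * ((γ 1 0 : ℤ) * τ + (γ 1 1 : ℤ)) / (2 * Real.pi * Complex.I) := by
  have hpi : (Real.pi : ℂ) ≠ 0 := by exact_mod_cast Real.pi_ne_zero
  let z : UpperHalfPlane := ⟨τ, hτ⟩
  have hz : (z : ℂ) = τ := rfl
  have hd : UpperHalfPlane.denom γ z = (γ 1 0 : ℤ) * τ + (γ 1 1 : ℤ) :=
    ModularGroup.denom_apply γ z
  have hd0 : (γ 1 0 : ℂ) * τ + (γ 1 1 : ℤ) ≠ 0 := hd ▸ UpperHalfPlane.denom_ne_zero γ z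
  have hs := congrFun (EisensteinSeries.G2_slash_action γ) z
  rw [ModularForm.SL_slash_apply, Pi.sub_apply, EisensteinSeries.D2, hd] at hs
  have hm : ((γ • z : UpperHalfPlane) : ℂ) =
      ((γ 0 0 : ℤ) * τ + (γ 0 1 : ℤ)) / ((γ 1 0 : ℤ) * τ + (γ 1 1 : ℤ)) := by
    rw [UpperHalfPlane.specialLinearGroup_apply]
    simp [hz]
  rw [← hm, E2_eq_G2, ← hz, E2_eq_G2, hz]
  rw [zpow_neg, zpow_ofNat] at hs
  have hG : EisensteinSeries.G2 (γ • z) = ((γ 1 0 : ℤ) * τ + (γ 1 1 : ℤ)) ^ 2 *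
      EisensteinSeries.G2 z - 2 * Real.pi * Complex.I * (γ 1 0 : ℤ) *
      ((γ 1 0 : ℤ) * τ + (γ 1 1 : ℤ)) := by
    field_simp at hs
    linear_combination hs
  rw [hG]
  field_simp
  ring_nf
  simp only [Complex.I_sq]
  ring
end
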